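/- Let p ≥ 2 and let a, b : ℤ → ℝ be p-periodic sequences. Let A be the bounded linear operator on ℓ²(ℤ) defined by (Au)_n = −b_n·u_{n−1} + a_n·u_n + b_n·u_{n+1}. If for some ε > 0 the ε-pseudospectrum Λ_ε(A) is path-connected, then ω_a ≤ 2(ε + max_{0≤i≤p−1}|b_i + b_{i+1}|)(p − 1). -/

import Mathlib

/-- The `ε`-pseudospectrum of an element `a` of a complex normed algebra:
the set of `z ∈ ℂ` such that `z - a` is not invertible or `‖(z - a)⁻¹‖ ≥ ε⁻¹`. -/
noncomputable def pseudospectrum {A : Type*} [NormedRing A] [NormedAlgebra ℂ A]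
    (ε : ℝ) (a : A) : Set ℂ :=
  {z : ℂ | z ∈ spectrum ℂ a ∨ ε⁻¹ ≤ ‖Ring.inverse (algebraMap ℂ A z - a)‖}

/-- The oscillation `ω_v = max { |v i - v j| : 0 ≤ i, j ≤ p-1 }` of a `p`-periodic
real sequence `v`. -/
noncomputable def osc (p : ℕ) (v : ℤ → ℝ) : ℝ :=
  ⨆ i : Fin p, ⨆ j : Fin p, |v ((i : ℕ) : ℤ) - v ((j : ℕ) : ℤ)|

open scoped InnerProductSpace
open Filter Topology

theorem tendsto_norm_pow_zero_of_spectrum {𝔸 : Type*} [NormedRing 𝔸] [NormedAlgebra ℂ 𝔸]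
    [CompleteSpace 𝔸] [Nontrivial 𝔸] (a : 𝔸) (h : ∀ z ∈ spectrum ℂ a, ‖z‖ < 1) :
    Tendsto (fun n : ℕ => ‖a ^ n‖) atTop (𝓝 0) := by
  have h1 : spectralRadius ℂ a < ((1 : NNReal) : ENNReal) :=
    spectrum.spectralRadius_lt_of_forall_lt a fun z hz => by
      rw [← NNReal.coe_lt_coe]; simpa using h z hz
  obtain ⟨r, hr, hr1⟩ := exists_between h1
  lift r to NNReal using hr1.ne_top
  have hev := (spectrum.pow_nnnorm_pow_one_div_tendsto_nhds_spectralRadius a).eventually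
    (gt_mem_nhds hr)
  have hr1' : (r : ℝ) < 1 := by exact_mod_cast hr1
  refine squeeze_zero' (Eventually.of_forall fun _ => norm_nonneg _) ?_
    (tendsto_pow_atTop_nhds_zero_of_lt_one r.coe_nonneg hr1')
  filter_upwards [hev, eventually_gt_atTop 0] with n hn hn0
  have hn0' : (n : ℝ) ≠ 0 := by positivity
  have := ENNReal.rpow_le_rpow hn.le (Nat.cast_nonneg' n : (0 : ℝ) ≤ n)
  rw [← ENNReal.rpow_mul, one_div_mul_cancel hn0', ENNReal.rpow_one, ENNReal.rpow_natCast] at this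
  exact_mod_cast this

section Hilbert

variable {H : Type*} [NormedAddCommGroup H] [InnerProductSpace ℂ H] [CompleteSpace H]

/-- A form of Lyapunov's inertia theorem: if `J * B` is accretive with `J` symmetric and the
spectrum of `B` lies in the open right half-plane, then `J` is positive. -/
theorem re_inner_nonneg_of_accretive [Nontrivial H] {J B : H →L[ℂ] H}
    (hJ : (J : H →ₗ[ℂ] H).IsSymmetric)
    (hJB : ∀ x, 0 ≤ (⟪J (B x), x⟫_ℂ).re) (hB : ∀ z ∈ spectrum ℂ B, 0 < z.re) (x : H) :
    0 ≤ (⟪J x, x⟫_ℂ).re := by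
  have hu : IsUnit (1 + B) := by
    have : (-1 : ℂ) ∉ spectrum ℂ B := fun h => by have := hB _ h; norm_num at this
    rw [spectrum.notMem_iff] at this
    have h2 := this.neg
    convert h2 using 1
    simp [add_comm]
  obtain ⟨U, hU⟩ := hu
  set V : H →L[ℂ] H := ((U⁻¹ : (H →L[ℂ] H)ˣ) : H →L[ℂ] H) with hV
  have hUV : (1 + B) * V = 1 := by rw [← hU, hV]; simp
  set C : H →L[ℂ] H := (1 - B) * V with hC
  have hCs : ∀ z ∈ spectrum ℂ C, ‖z‖ < 1 := by
    intro z hz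
    by_contra! hz1
    refine hz ?_
    change IsUnit (algebraMap ℂ (H →L[ℂ] H) z - C)
    have key : algebraMap ℂ (H →L[ℂ] H) z - C
        = (algebraMap ℂ (H →L[ℂ] H) (z - 1) + algebraMap ℂ (H →L[ℂ] H) (z + 1) * B) * V := by
      calc algebraMap ℂ (H →L[ℂ] H) z - C
          = algebraMap ℂ (H →L[ℂ] H) z * ((1 + B) * V) - C := by rw [hUV, mul_one]
        _ = _ := by rw [hC, map_sub, map_add, map_one]; noncomm_ring
    rw [key]
    refine IsUnit.mul ?_ (Units.isUnit _)
    by_cases hz' : z + 1 = 0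
    · rw [hz', map_zero, zero_mul, add_zero]
      refine (IsUnit.mk0 (z - 1) ?_).map _
      intro h
      have : (2 : ℂ) = 0 := by linear_combination hz' - h
      norm_num at this
    · have hn : (1 - z) / (z + 1) ∉ spectrum ℂ B := by
        intro h
        have h1 := hB _ h
        have h3 : ((1 - z) / (z + 1)).re = (1 - Complex.normSq z) / Complex.normSq (z + 1) := by
          rw [Complex.div_re]
          have : Complex.normSq (z + 1) ≠ 0 := by simpa using hz'
          field_simp
          simp [Complex.normSq_apply]
          ring
        rw [h3, Complex.normSq_eq_norm_sq] at h1
        have h4 : 0 < Complex.normSq (z + 1) := Complex.normSq_pos.mpr hz'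
        rw [div_pos_iff_of_pos_right h4] at h1
        nlinarith
      rw [spectrum.notMem_iff] at hn
      have h5 := ((IsUnit.mk0 (-(z + 1)) (neg_ne_zero.mpr hz')).map
        (algebraMap ℂ (H →L[ℂ] H))).mul hn
      convert h5 using 1
      rw [mul_sub, ← map_mul]
      have : -(z + 1) * ((1 - z) / (z + 1)) = z - 1 := by field_simp; ring
      rw [this, map_neg]; noncomm_ring
  have hdec : ∀ y, (⟪J (C y), C y⟫_ℂ).re ≤ (⟪J y, y⟫_ℂ).re := by
    intro y
    have hy : y = V y + B (V y) := by
      have := congrArg (fun F : H →L[ℂ] H => F y) hUV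
      simpa using this.symm
    have hCy : C y = V y - B (V y) := by simp [hC]
    have h1 := hJB (V y)
    set w := V y
    have h2 : (⟪J w, B w⟫_ℂ).re = (⟪J (B w), w⟫_ℂ).re := by
      rw [← inner_conj_symm, Complex.conj_re]
      exact congrArg Complex.re (hJ (B w) w).symm
    rw [hCy]
    conv_rhs => rw [hy]
    simp only [map_sub, map_add, inner_sub_left, inner_sub_right, inner_add_left, inner_add_right,
      Complex.sub_re, Complex.add_re]
    linarith
  have hpow : ∀ n : ℕ, (⟪J ((C ^ n) x), (C ^ n) x⟫_ℂ).re ≤ (⟪J x, x⟫_ℂ).re := by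
    intro n
    induction n with
    | zero => simp
    | succ n ih => 
      rw [pow_succ']
      exact (hdec _).trans ih
  have hlim : Tendsto (fun n : ℕ => (C ^ n) x) atTop (𝓝 0) := by
    rw [tendsto_zero_iff_norm_tendsto_zero]
    refine squeeze_zero (fun _ => norm_nonneg _) (fun n => (C ^ n).le_opNorm x) ?_
    simpa using (tendsto_norm_pow_zero_of_spectrum C hCs).mul_const ‖x‖
  have hcont : Continuous fun y => (⟪J y, y⟫_ℂ).re := by fun_prop
  have hl := (hcont.tendsto 0).comp hlim
  simp only [map_zero, inner_zero_left, Complex.zero_re] at hl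
  exact le_of_tendsto' hl hpow

theorem re_ofReal_mul_inner_self {H : Type*} [NormedAddCommGroup H] [InnerProductSpace ℂ H]
    (r : ℝ) (x : H) : ((r : ℂ) * ⟪x, x⟫_ℂ).re = r * ‖x‖ ^ 2 := by
  rw [Complex.re_ofReal_mul, ← inner_self_eq_norm_sq (𝕜 := ℂ)]
  rfl

/-- A self-adjoint operator with a spectral gap `(α, β)` admits a symmetry `J` such that
`J (T - (α + β) / 2)` is bounded below by half of the gap length. -/
theorem exists_involution_of_gap {T : H →L[ℂ] H} (hT : IsSelfAdjoint T) {α β : ℝ} (hαβ : α < β)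
    (hgap : ∀ s ∈ Set.Ioo α β, (s : ℂ) ∉ spectrum ℂ T) :
    ∃ J : H →L[ℂ] H, (J : H →ₗ[ℂ] H).IsSymmetric ∧ (∀ x, J (J x) = x) ∧
      ∀ x, (β - α) / 2 * ‖x‖ ^ 2 ≤ (⟪J (T x - (((α + β) / 2 : ℝ) : ℂ) • x), x⟫_ℂ).re := by
  set s : ℝ := (α + β) / 2 with hs
  have hout : ∀ x ∈ spectrum ℝ T, x ≤ α ∨ β ≤ x := by
    intro x hx
    by_contra! h
    exact hgap x h ((spectrum.algebraMap_mem_iff ℂ).mpr hx)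
  set f : ℝ → ℝ := fun x => if x < s then -1 else 1 with hf
  have hfc : ContinuousOn f (spectrum ℝ T) := by
    intro x hx
    refine ContinuousAt.continuousWithinAt ?_
    have hxs : x < s ∨ s < x := by
      rcases hout x hx with h | h
      · left; linarith
      · right; linarith
    rcases hxs with h | h
    · refine (continuousAt_const (y := (-1 : ℝ))).congr ?_
      filter_upwards [gt_mem_nhds h] with y hy
      simp [hf, hy]
    · refine (continuousAt_const (y := (1 : ℝ))).congr ?_
      filter_upwards [lt_mem_nhds h] with y hy
      simp [hf, hy.le.not_gt]
  have hff : cfc f T * cfc f T = 1 := by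
    rw [← cfc_mul f f T hfc hfc, ← cfc_one ℝ T]
    refine cfc_congr fun x _ => ?_
    simp only [hf]
    split_ifs <;> norm_num
  have hle : algebraMap ℝ (H →L[ℂ] H) ((β - α) / 2)
      ≤ cfc f T * (T - algebraMap ℝ (H →L[ℂ] H) s) := by
    have h1 : T - algebraMap ℝ (H →L[ℂ] H) s = cfc (fun x : ℝ => x - s) T := by
      rw [cfc_sub (fun x : ℝ => x) (fun _ => s) T, cfc_id' ℝ T, cfc_const s T]
    rw [h1, ← cfc_mul f _ T hfc]
    refine algebraMap_le_cfc _ _ T (fun x hx => ?_) (by fun_prop)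
    rcases hout x hx with h | h
    · have : x < s := by linarith
      simp only [hf, this, if_true]; linarith
    · have : ¬ x < s := by linarith
      simp only [hf, this, if_false]; linarith
  refine ⟨cfc f T, ?_, ?_, ?_⟩
  · exact (ContinuousLinearMap.isSelfAdjoint_iff_isSymmetric).mp (cfc_predicate f T)
  · exact fun x => congrArg (fun F : H →L[ℂ] H => F x) hff
  · intro x
    have h2 := ((ContinuousLinearMap.le_def _ _).mp hle).re_inner_nonneg_left x
    simp only [sub_apply, inner_sub_left, map_sub, sub_nonneg] at h2
    have h3 : ∀ r : ℝ, algebraMap ℝ (H →L[ℂ] H) r x = (r : ℂ) • x := fun r => by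
      rw [Algebra.algebraMap_eq_smul_one]; simp
    have h4 : (cfc f T * (T - algebraMap ℝ (H →L[ℂ] H) s)) x = cfc f T (T x - (s : ℂ) • x) := by
      rw [mul_apply_eq_comp, sub_apply, h3]
    rw [h3, h4, inner_smul_left, Complex.conj_ofReal] at h2
    rw [← re_ofReal_mul_inner_self]
    exact h2

/-- If `J` is an involution, its positivity forces `J = 1`. -/
theorem involution_apply_eq_self {H : Type*} [NormedAddCommGroup H] [InnerProductSpace ℂ H]
    {J : H →L[ℂ] H} (hJJ : ∀ x, J (J x) = x)
    (hpos : ∀ x, 0 ≤ (⟪J x, x⟫_ℂ).re) (x : H) : J x = x := by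
  have h := hpos (x - J x)
  rw [map_sub, hJJ, ← neg_sub, inner_neg_left, Complex.neg_re, neg_nonneg] at h
  have h2 : ‖x - J x‖ ^ 2 ≤ 0 := by
    rw [← inner_self_eq_norm_sq (𝕜 := ℂ)]; exact h
  have h3 : ‖x - J x‖ = 0 := by nlinarith [norm_nonneg (x - J x)]
  exact (sub_eq_zero.mp (norm_eq_zero.mp h3)).symm

theorem norm_involution {H : Type*} [NormedAddCommGroup H] [InnerProductSpace ℂ H]
    {J : H →L[ℂ] H} (hJ : (J : H →ₗ[ℂ] H).IsSymmetric)
    (hJJ : ∀ x, J (J x) = x) (x : H) : ‖J x‖ = ‖x‖ := by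
  have h : ‖J x‖ ^ 2 = ‖x‖ ^ 2 := by
    rw [← inner_self_eq_norm_sq (𝕜 := ℂ), ← inner_self_eq_norm_sq (𝕜 := ℂ)]
    have := hJ x (J x)
    simp only [ContinuousLinearMap.coe_coe, hJJ] at this
    rw [this]
  exact (sq_eq_sq₀ (norm_nonneg _) (norm_nonneg _)).mp h

theorem notMem_pseudospectrum_of_accretive {A J : H →L[ℂ] H} {z : ℂ} {ε c : ℝ}
    (hJ : (J : H →ₗ[ℂ] H).IsSymmetric) (hJJ : ∀ x, J (J x) = x) (hε : 0 < ε) (hc : ε < c)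
    (h : ∀ x, c * ‖x‖ ^ 2 ≤ (⟪J (A x - z • x), x⟫_ℂ).re) : z ∉ pseudospectrum ε A := by
  have hc0 : 0 < c := hε.trans hc
  set D : H →L[ℂ] H := algebraMap ℂ (H →L[ℂ] H) z - A with hD
  have hDx : ∀ x, A x - z • x = - D x := fun x => by
    simp [hD, Algebra.algebraMap_eq_smul_one]
  have hJu : IsUnit J := by
    refine ⟨⟨J, J, ?_, ?_⟩, rfl⟩ <;> · ext x; exact hJJ x
  have hJD : IsUnit (J * D) := by
    refine ContinuousLinearMap.isUnit_of_forall_le_norm_inner_map _ (c := ⟨c, hc0.le⟩) hc0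
      fun x => ?_
    have h1 := h x
    rw [hDx, map_neg, inner_neg_left] at h1
    calc ‖x‖ ^ 2 * c ≤ (-⟪J (D x), x⟫_ℂ).re := by rw [mul_comm]; exact h1
      _ ≤ ‖-⟪J (D x), x⟫_ℂ‖ := Complex.re_le_norm _
      _ = _ := norm_neg _
  have hDu : IsUnit D := by
    have := hJu.mul hJD
    have h2 : J * (J * D) = D := by ext x; exact hJJ _
    rwa [h2] at this
  have hlow : ∀ x, c * ‖x‖ ≤ ‖D x‖ := by
    intro x
    rcases eq_or_ne x 0 with rfl | hx
    · simp
    have h1 := h x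
    have h2 : (⟪J (A x - z • x), x⟫_ℂ).re ≤ ‖D x‖ * ‖x‖ := by
      refine (Complex.re_le_norm _).trans ((norm_inner_le_norm _ _).trans ?_)
      rw [norm_involution hJ hJJ, hDx, norm_neg]
    have hx' : 0 < ‖x‖ := norm_pos_iff.mpr hx
    have h3 : c * ‖x‖ * ‖x‖ ≤ ‖D x‖ * ‖x‖ := by nlinarith
    exact le_of_mul_le_mul_right h3 hx'
  rintro (hz | hz)
  · exact hz hDu
  · have hinv : ‖Ring.inverse D‖ ≤ c⁻¹ := by
      refine ContinuousLinearMap.opNorm_le_bound _ (inv_nonneg.mpr hc0.le) fun y => ?_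
      have h4 : D (Ring.inverse D y) = y :=
        congrArg (fun F : H →L[ℂ] H => F y) (Ring.mul_inverse_cancel D hDu)
      have h5 := hlow (Ring.inverse D y)
      rw [h4] at h5
      rw [inv_mul_eq_div, le_div_iff₀ hc0]
      linarith
    have := inv_strictAnti₀ hε hc
    linarith

/-- If a bounded perturbation of a self-adjoint operator `T` has path-connected `ε`-pseudospectrum,
then the spectral gaps of `T` have length at most `2 (ε + M)`, with `M` bounding the
perturbation. -/
theorem gap_length_le {A T : H →L[ℂ] H} (hT : IsSelfAdjoint T) {M ε α β : ℝ}
    (hR : ‖A - T‖ ≤ M) (hε : 0 < ε) (hconn : IsPathConnected (pseudospectrum ε A)) (hαβ : α < β)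
    (hgap : ∀ s ∈ Set.Ioo α β, (s : ℂ) ∉ spectrum ℂ T) {x y : H} (hx : x ≠ 0) (hy : y ≠ 0)
    (hxα : (⟪T x, x⟫_ℂ).re ≤ α * ‖x‖ ^ 2) (hyβ : β * ‖y‖ ^ 2 ≤ (⟪T y, y⟫_ℂ).re) :
    β - α ≤ 2 * (ε + M) := by
  by_contra! hlong
  obtain ⟨J, hJ, hJJ, hlow⟩ := exists_involution_of_gap hT hαβ hgap
  set s : ℝ := (α + β) / 2 with hs
  set c : ℝ := (β - α) / 2 - M with hc
  have hcε : ε < c := by linarith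
  have : Nontrivial H := ⟨x, 0, hx⟩
  have hAlow : ∀ u, c * ‖u‖ ^ 2 ≤ (⟪J (A u - (s : ℂ) • u), u⟫_ℂ).re := by
    intro u
    have h1 := hlow u
    have h2 : A u - (s : ℂ) • u = (T u - (s : ℂ) • u) + (A - T) u := by simp
    have h3 : ‖⟪J ((A - T) u), u⟫_ℂ‖ ≤ M * ‖u‖ ^ 2 := by
      refine (norm_inner_le_norm _ _).trans ?_
      rw [norm_involution hJ hJJ, pow_two, ← mul_assoc]
      gcongr
      exact ((A - T).le_opNorm u).trans (by gcongr)
    have h4 := Complex.abs_re_le_norm ⟪J ((A - T) u), u⟫_ℂ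
    rw [h2, map_add, inner_add_left, Complex.add_re]
    have := neg_abs_le (⟪J ((A - T) u), u⟫_ℂ).re
    rw [hc, sub_mul]
    linarith
  have hline : ∀ z ∈ pseudospectrum ε A, z.re ≠ s := by
    intro z hz hzs
    refine notMem_pseudospectrum_of_accretive hJ hJJ hε hcε (fun u => ?_) hz
    have h1 := hAlow u
    have h2 : A u - z • u = (A u - (s : ℂ) • u) - ((z.im : ℂ) * Complex.I) • u := by
      have : z = s + z.im * Complex.I := by rw [← hzs]; exact (Complex.re_add_im z).symm
      conv_lhs => rw [this]
      rw [add_smul]; abel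
    have h3 : (⟪J u, u⟫_ℂ).im = 0 := hJ.im_inner_apply_self u
    rw [h2, map_sub J, map_smul, inner_sub_left, inner_smul_left, Complex.sub_re, Complex.mul_re]
    have h5 : ((starRingEnd ℂ) ((z.im : ℂ) * Complex.I)).re = 0 := by simp
    rw [h3, h5]
    linarith
  have hord : (Complex.re '' pseudospectrum ε A).OrdConnected :=
    (hconn.isConnected.isPreconnected.image _ Complex.continuous_re.continuousOn).ordConnected
  have hside : (∀ z ∈ pseudospectrum ε A, s < z.re) ∨ (∀ z ∈ pseudospectrum ε A, z.re < s) := by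
    by_contra! h
    obtain ⟨⟨z, hz, hzs⟩, w, hw, hws⟩ := h
    obtain ⟨t, ht, hts⟩ := hord.out ⟨z, hz, rfl⟩ ⟨w, hw, rfl⟩ ⟨hzs, hws⟩
    exact hline t ht hts
  have hshift : ∀ z, z ∈ spectrum ℂ (A - algebraMap ℂ (H →L[ℂ] H) s) →
      z + s ∈ pseudospectrum ε A := by
    intro z hz
    refine Or.inl fun hu => hz ?_
    change IsUnit _
    convert (show IsUnit _ from hu) using 1
    rw [map_add]; abel
  have hBx : ∀ u, (A - algebraMap ℂ (H →L[ℂ] H) s) u = A u - (s : ℂ) • u := fun u => by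
    simp [Algebra.algebraMap_eq_smul_one]
  have hc0 : 0 < c := hε.trans hcε
  rcases hside with hside | hside
  · have hpos := re_inner_nonneg_of_accretive (B := A - algebraMap ℂ (H →L[ℂ] H) s) hJ
      (fun u => by rw [hBx]; exact (by positivity : 0 ≤ c * ‖u‖ ^ 2).trans (hAlow u))
      (fun z hz => by have := hside _ (hshift z hz); simpa using this)
    have h1 := hlow x
    rw [involution_apply_eq_self hJJ hpos, inner_sub_left, inner_smul_left, Complex.conj_ofReal,
      Complex.sub_re, re_ofReal_mul_inner_self] at h1
    have : 0 < ‖x‖ ^ 2 := by positivity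
    nlinarith
  · have hpos := re_inner_nonneg_of_accretive (J := -J) (B := -(A - algebraMap ℂ (H →L[ℂ] H) s))
      (by intro u v; simpa using hJ u v)
      (fun u => by
        simp only [neg_apply, map_neg, neg_neg]
        rw [hBx]; exact (by positivity : 0 ≤ c * ‖u‖ ^ 2).trans (hAlow u))
      (fun z hz => by
        rw [← spectrum.neg_eq, Set.mem_neg] at hz
        have := hside _ (hshift _ hz); simpa using this)
    have h1 := hlow y
    have h2 := involution_apply_eq_self (J := -J) (by simpa using hJJ) hpos
      (T y - (s : ℂ) • y)
    rw [neg_apply, neg_eq_iff_eq_neg] at h2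
    rw [h2, inner_neg_left, inner_sub_left, inner_smul_left, Complex.conj_ofReal,
      Complex.neg_re, Complex.sub_re, re_ofReal_mul_inner_self] at h1
    have : 0 < ‖y‖ ^ 2 := by positivity
    nlinarith

end Hilbert

section FiniteDimensional

variable {V : Type*} [NormedAddCommGroup V] [InnerProductSpace ℂ V]

/-- If the quadratic form of `S - s` is `≥ c` on `E` and `≤ -c` on `F`, and `E`, `F` have
complementary dimensions, then `S - s` is bounded below by `c / 2`. -/
theorem norm_le_of_definite_subspaces [FiniteDimensional ℂ V] {S : V →ₗ[ℂ] V} (hS : S.IsSymmetric)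
    {s c : ℝ} (hc : 0 < c)
    (E F : Submodule ℂ V)
    (hdim : Module.finrank ℂ V ≤ Module.finrank ℂ E + Module.finrank ℂ F)
    (hE : ∀ x ∈ E, (s + c) * ‖x‖ ^ 2 ≤ (⟪S x, x⟫_ℂ).re)
    (hF : ∀ x ∈ F, (⟪S x, x⟫_ℂ).re ≤ (s - c) * ‖x‖ ^ 2) (v : V) :
    c * ‖v‖ ≤ 2 * ‖S v - (s : ℂ) • v‖ := by
  have hdisj : Disjoint E F := by
    rw [Submodule.disjoint_def]
    intro x hxE hxF
    have h1 := hE x hxE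
    have h2 := hF x hxF
    have h3 : ‖x‖ ^ 2 = 0 := by nlinarith [sq_nonneg ‖x‖]
    simpa using h3
  have htop : E ⊔ F = ⊤ := by
    refine Submodule.eq_top_of_disjoint E F ?_ hdisj
    exact hdim
  obtain ⟨x, hx, y, hy, rfl⟩ := Submodule.mem_sup.mp (htop ▸ Submodule.mem_top : v ∈ E ⊔ F)
  set w := S (x + y) - (s : ℂ) • (x + y) with hw
  have h1 := hE x hx
  have h2 := hF y hy
  have h3 : (⟪S y, x⟫_ℂ).re = (⟪S x, y⟫_ℂ).re := by
    rw [hS y x, ← inner_conj_symm, Complex.conj_re]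
  have h4 : (⟪y, x⟫_ℂ).re = (⟪x, y⟫_ℂ).re := by
    rw [← inner_conj_symm, Complex.conj_re]
  have h5 : c * (‖x‖ ^ 2 + ‖y‖ ^ 2) ≤ (⟪w, x - y⟫_ℂ).re := by
    rw [hw, map_add, smul_add]
    simp only [inner_sub_left, inner_sub_right, inner_add_left, inner_smul_left,
      Complex.conj_ofReal, Complex.sub_re, Complex.add_re, re_ofReal_mul_inner_self]
    simp only [Complex.re_ofReal_mul, h3, h4]
    linarith
  have h6 : (⟪w, x - y⟫_ℂ).re ≤ ‖w‖ * ‖x - y‖ :=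
    (Complex.re_le_norm _).trans (norm_inner_le_norm _ _)
  have h7 := parallelogram_law_with_norm ℂ x y
  have hxy : ‖x + y‖ ^ 2 + ‖x - y‖ ^ 2 = 2 * (‖x‖ ^ 2 + ‖y‖ ^ 2) := by linarith
  have hw0 := norm_nonneg w
  have h8 : c * (‖x + y‖ ^ 2 + ‖x - y‖ ^ 2) ≤ 2 * (‖w‖ * ‖x - y‖) := by
    rw [hxy]; linarith
  rcases le_total ‖x + y‖ ‖x - y‖ with h | h
  · rcases (norm_nonneg (x - y)).eq_or_lt with h0 | h0
    · rw [← h0] at h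
      nlinarith [norm_nonneg (x + y)]
    · have : c * ‖x - y‖ * ‖x - y‖ ≤ 2 * ‖w‖ * ‖x - y‖ := by
        nlinarith [mul_nonneg hc.le (sq_nonneg ‖x + y‖)]
      have := le_of_mul_le_mul_right this h0
      nlinarith
  · rcases (norm_nonneg (x + y)).eq_or_lt with h0 | h0
    · rw [← h0]; simp
    · have : c * ‖x + y‖ * ‖x + y‖ ≤ 2 * ‖w‖ * ‖x + y‖ := by
        nlinarith [mul_nonneg hc.le (sq_nonneg ‖x - y‖), mul_le_mul_of_nonneg_left h hw0]
      exact le_of_mul_le_mul_right this h0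

theorem re_inner_eq_sum_eigenvalues [FiniteDimensional ℂ V] {S : V →ₗ[ℂ] V} (hS : S.IsSymmetric)
    {n : ℕ} (hn : Module.finrank ℂ V = n) (x : V) :
    (⟪S x, x⟫_ℂ).re =
      ∑ i, hS.eigenvalues hn i * ‖⟪hS.eigenvectorBasis hn i, x⟫_ℂ‖ ^ 2 := by
  rw [← (hS.eigenvectorBasis hn).sum_inner_mul_inner, Complex.re_sum]
  refine Finset.sum_congr rfl fun i _ => ?_
  rw [hS x, hS.apply_eigenvectorBasis, inner_smul_right, ← inner_conj_symm x, mul_assoc,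
    Complex.conj_mul']
  norm_cast
  exact Complex.re_ofReal_mul _ _

theorem exists_submodule_of_eigenvalues [FiniteDimensional ℂ V] {S : V →ₗ[ℂ] V}
    (hS : S.IsSymmetric) {n : ℕ} (hn : Module.finrank ℂ V = n) (I : Finset (Fin n)) :
    ∃ E : Submodule ℂ V, Module.finrank ℂ E = I.card ∧
      (∀ r : ℝ, (∀ i ∈ I, r ≤ hS.eigenvalues hn i) → ∀ x ∈ E, r * ‖x‖ ^ 2 ≤ (⟪S x, x⟫_ℂ).re) ∧
      (∀ r : ℝ, (∀ i ∈ I, hS.eigenvalues hn i ≤ r) → ∀ x ∈ E, (⟪S x, x⟫_ℂ).re ≤ r * ‖x‖ ^ 2) := by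
  set e := hS.eigenvectorBasis hn with he
  have hli : LinearIndependent ℂ (fun i : I => e i) :=
    e.orthonormal.linearIndependent.comp _ Subtype.val_injective
  refine ⟨Submodule.span ℂ (Set.range fun i : I => e i), ?_, ?_⟩
  · rw [finrank_span_eq_card hli, Fintype.card_coe]
  have hzero : ∀ x ∈ Submodule.span ℂ (Set.range fun i : I => e i), ∀ i ∉ I, ⟪e i, x⟫_ℂ = 0 := by
    intro x hx i hi
    induction hx using Submodule.span_induction with
    | mem x hx =>
      obtain ⟨j, rfl⟩ := hx
      exact e.orthonormal.2 fun h => hi (h ▸ j.2)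
    | zero => simp
    | add x y _ _ hx hy => rw [inner_add_right, hx, hy, add_zero]
    | smul a x _ hx => rw [inner_smul_right, hx, mul_zero]
  constructor <;>
  · intro r hr x hx
    rw [re_inner_eq_sum_eigenvalues hS hn, ← e.sum_sq_norm_inner_right x, Finset.mul_sum]
    refine Finset.sum_le_sum fun i _ => ?_
    by_cases hi : i ∈ I
    · exact mul_le_mul_of_nonneg_right (hr i hi) (sq_nonneg _)
    · rw [hzero x hx i hi]; simp

/-- The trace of a symmetric operator expressed in an arbitrary orthonormal basis. -/
theorem sum_re_inner_eq_sum_eigenvalues [FiniteDimensional ℂ V] {S : V →ₗ[ℂ] V}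
    (hS : S.IsSymmetric) {n : ℕ} (hn : Module.finrank ℂ V = n) {ι : Type*} [Fintype ι]
    (b : OrthonormalBasis ι ℂ V) :
    ∑ i, (⟪b i, S (b i)⟫_ℂ).re = ∑ i, hS.eigenvalues hn i := by
  have h := congrArg Complex.re (hS.trace_eq_sum_eigenvalues hn)
  rw [LinearMap.trace_eq_sum_inner S b, Complex.re_sum] at h
  exact h

end FiniteDimensional

section Jacobi

/-- The formal Jacobi operator with diagonal `a` and off-diagonal entries `e`, acting on all
two-sided sequences. -/
noncomputable def jacobi (a e : ℤ → ℝ) : (ℤ → ℂ) →ₗ[ℂ] (ℤ → ℂ) where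
  toFun v n := e n * v (n - 1) + a n * v n + e (n + 1) * v (n + 1)
  map_add' v w := by ext n; simp only [Pi.add_apply]; ring
  map_smul' r v := by ext n; simp only [Pi.smul_apply, smul_eq_mul, RingHom.id_apply]; ring

theorem jacobi_apply (a e : ℤ → ℝ) (v : ℤ → ℂ) (n : ℤ) :
    jacobi a e v n = e n * v (n - 1) + a n * v n + e (n + 1) * v (n + 1) := rfl

open ComplexConjugate

/-- The Wronskian-type boundary term of the Jacobi operator. -/
noncomputable def jacobiBoundary (e : ℤ → ℝ) (v w : ℤ → ℂ) (n : ℤ) : ℂ :=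
  e n * (conj (v (n - 1)) * w n - conj (v n) * w (n - 1))

theorem jacobi_green (a e : ℤ → ℝ) (v w : ℤ → ℂ) (n : ℤ) :
    conj (jacobi a e v n) * w n - conj (v n) * jacobi a e w n =
      jacobiBoundary e v w n - jacobiBoundary e v w (n + 1) := by
  simp only [jacobi_apply, jacobiBoundary, map_add, map_mul, Complex.conj_ofReal,
    add_sub_cancel_right]
  ring

theorem sum_jacobi_green (a e : ℤ → ℝ) (v w : ℤ → ℂ) (m : ℤ) (N : ℕ) :
    ∑ i ∈ Finset.range N, conj (jacobi a e v (m + i)) * w (m + i) -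
      ∑ i ∈ Finset.range N, conj (v (m + i)) * jacobi a e w (m + i) =
      jacobiBoundary e v w m - jacobiBoundary e v w (m + N) := by
  rw [← Finset.sum_sub_distrib]
  simp only [jacobi_green]
  have := Finset.sum_range_sub' (fun i : ℕ => jacobiBoundary e v w (m + i)) N
  simpa [add_assoc] using this

/-- Extension by zero of a finite vector placed at the sites `k, …, k + q - 1`. -/
noncomputable def zeroExt {q : ℕ} (k : ℤ) : EuclideanSpace ℂ (Fin q) →ₗ[ℂ] (ℤ → ℂ) where
  toFun f n := ∑ i : Fin q, if n = k + (i : ℕ) then f i else 0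
  map_add' f g := by
    ext n
    simp only [Pi.add_apply, PiLp.add_apply, ← Finset.sum_add_distrib]
    exact Finset.sum_congr rfl fun i _ => by split_ifs <;> simp
  map_smul' r f := by
    ext n
    simp only [Pi.smul_apply, PiLp.smul_apply, smul_eq_mul, RingHom.id_apply, Finset.mul_sum]
    exact Finset.sum_congr rfl fun i _ => by split_ifs <;> simp

theorem zeroExt_apply_add {q : ℕ} (k : ℤ) (f : EuclideanSpace ℂ (Fin q)) (i : Fin q) :
    zeroExt k f (k + (i : ℕ)) = f i := by
  change (∑ j : Fin q, if k + ((i : ℕ) : ℤ) = k + (j : ℕ) then f j else 0) = f i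
  rw [Finset.sum_eq_single i]
  · simp
  · intro j _ hj
    rw [if_neg]
    intro h
    exact hj (Fin.ext (by omega))
  · simp

theorem zeroExt_apply_of_notMem {q : ℕ} (k : ℤ) (f : EuclideanSpace ℂ (Fin q)) {n : ℤ}
    (hn : n < k ∨ k + q ≤ n) : zeroExt k f n = 0 := by
  change (∑ i : Fin q, if n = k + ((i : ℕ) : ℤ) then f i else 0) = 0
  refine Finset.sum_eq_zero fun i _ => if_neg ?_
  have := i.2
  omega

/-- Restriction of a sequence to the sites `k, …, k + q - 1`. -/
noncomputable def restrict (q : ℕ) (k : ℤ) : (ℤ → ℂ) →ₗ[ℂ] EuclideanSpace ℂ (Fin q) where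
  toFun v := WithLp.toLp 2 fun i => v (k + (i : ℕ))
  map_add' _ _ := rfl
  map_smul' _ _ := rfl

theorem restrict_apply (q : ℕ) (k : ℤ) (v : ℤ → ℂ) (i : Fin q) :
    restrict q k v i = v (k + (i : ℕ)) := rfl

theorem restrict_zeroExt {q : ℕ} (k : ℤ) (f : EuclideanSpace ℂ (Fin q)) :
    restrict q k (zeroExt k f) = f := by
  ext i
  rw [restrict_apply, zeroExt_apply_add]

theorem inner_restrict (q : ℕ) (k : ℤ) (v w : ℤ → ℂ) :
    ⟪restrict q k v, restrict q k w⟫_ℂ =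
      ∑ i ∈ Finset.range q, conj (v (k + i)) * w (k + i) := by
  rw [← Fin.sum_univ_eq_sum_range (fun i : ℕ => conj (v (k + i)) * w (k + i)), PiLp.inner_apply]
  refine Finset.sum_congr rfl fun i _ => ?_
  rw [restrict_apply, restrict_apply, RCLike.inner_apply, mul_comm]

theorem norm_sq_restrict (q : ℕ) (k : ℤ) (v : ℤ → ℂ) :
    ‖restrict q k v‖ ^ 2 = ∑ i ∈ Finset.range q, ‖v (k + i)‖ ^ 2 := by
  rw [EuclideanSpace.norm_sq_eq, ← Fin.sum_univ_eq_sum_range (fun i : ℕ => ‖v (k + i)‖ ^ 2)]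
  rfl

/-- The compression of the Jacobi operator to the sites `k, …, k + q - 1`
(Dirichlet boundary conditions). -/
noncomputable def dirichlet (a e : ℤ → ℝ) (q : ℕ) (k : ℤ) :
    EuclideanSpace ℂ (Fin q) →ₗ[ℂ] EuclideanSpace ℂ (Fin q) :=
  restrict q k ∘ₗ jacobi a e ∘ₗ zeroExt k

theorem dirichlet_apply (a e : ℤ → ℝ) {q : ℕ} (k : ℤ) (f : EuclideanSpace ℂ (Fin q)) :
    dirichlet a e q k f = restrict q k (jacobi a e (zeroExt k f)) := rfl

theorem dirichlet_isSymmetric (a e : ℤ → ℝ) (q : ℕ) (k : ℤ) :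
    (dirichlet a e q k).IsSymmetric := by
  intro f g
  rw [dirichlet_apply, dirichlet_apply]
  conv_lhs => rw [← restrict_zeroExt k g]
  conv_rhs => rw [← restrict_zeroExt k f]
  rw [inner_restrict, inner_restrict, ← sub_eq_zero, sum_jacobi_green, jacobiBoundary,
    jacobiBoundary, zeroExt_apply_of_notMem k f (n := k - 1) (by omega),
    zeroExt_apply_of_notMem k g (n := k - 1) (by omega),
    zeroExt_apply_of_notMem k f (n := k + q) (by omega),
    zeroExt_apply_of_notMem k g (n := k + q) (by omega)]
  simp

theorem sum_eigenvalues_dirichlet (a e : ℤ → ℝ) (q : ℕ) (k : ℤ) :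
    ∑ i, (dirichlet_isSymmetric a e q k).eigenvalues (finrank_euclideanSpace_fin) i =
      ∑ i ∈ Finset.range q, a (k + i) := by
  rw [← sum_re_inner_eq_sum_eigenvalues _ _ (EuclideanSpace.basisFun (Fin q) ℂ),
    ← Fin.sum_univ_eq_sum_range (fun i : ℕ => a (k + i))]
  refine Finset.sum_congr rfl fun i _ => ?_
  have hz : ∀ n : ℤ, n ≠ k + (i : ℕ) → zeroExt k (EuclideanSpace.single i (1 : ℂ)) n = 0 := by
    intro n hn
    change (∑ j : Fin q, if n = k + ((j : ℕ) : ℤ) then EuclideanSpace.single i (1 : ℂ) j else 0) = 0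
    refine Finset.sum_eq_zero fun j _ => ?_
    split_ifs with h
    · have hj : j ≠ i := by rintro rfl; exact hn h
      simp [hj]
    · rfl
  rw [EuclideanSpace.basisFun_apply, EuclideanSpace.inner_single_left, dirichlet_apply,
    restrict_apply, jacobi_apply, hz (k + (i : ℕ) - 1) (by omega),
    hz (k + (i : ℕ) + 1) (by omega), zeroExt_apply_add]
  simp

variable {q : ℕ}

/-- Sequences multiplied by `ζ` when translated by one period `q + 1`. -/
def IsQuasiPeriodic (q : ℕ) (ζ : ℂ) (v : ℤ → ℂ) : Prop := ∀ n : ℤ, v (n + (q + 1)) = ζ * v n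

theorem IsQuasiPeriodic.jacobi {a e : ℤ → ℝ} (ha : ∀ n, a (n + (q + 1)) = a n)
    (he : ∀ n, e (n + (q + 1)) = e n) {ζ : ℂ} {v : ℤ → ℂ} (hv : IsQuasiPeriodic q ζ v) :
    IsQuasiPeriodic q ζ (jacobi a e v) := by
  intro n
  have h1 : n + (q + 1 : ℤ) - 1 = n - 1 + (q + 1) := by ring
  have h2 : n + (q + 1 : ℤ) + 1 = n + 1 + (q + 1) := by ring
  rw [jacobi_apply, jacobi_apply, h1, h2, hv, hv, hv, ha, he, he]
  ring

theorem IsQuasiPeriodic.eq_zpow_mul {ζ : ℂ} (hζ : ζ ≠ 0) {v : ℤ → ℂ}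
    (hv : IsQuasiPeriodic q ζ v) (n r : ℤ) : v (n + r * (q + 1)) = ζ ^ r * v n := by
  induction r using Int.induction_on with
  | zero => simp
  | succ r ih =>
    rw [add_mul, one_mul, ← add_assoc, hv, ih, zpow_add_one₀ hζ]
    ring
  | pred r ih =>
    have h : n + (-(r : ℤ)) * (q + 1) = n + (-(r : ℤ) - 1) * (q + 1) + (q + 1) := by ring
    rw [h, hv] at ih
    rw [zpow_sub_one₀ hζ]
    field_simp
    linear_combination ih

/-- The quasi-periodic sequence agreeing with `g` on the window `m, …, m + q`. -/
noncomputable def quasiExt (q : ℕ) (ζ : ℂ) (m : ℤ) : (ℤ → ℂ) →ₗ[ℂ] (ℤ → ℂ) where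
  toFun g n := ζ ^ ((n - m) / (q + 1)) * g (m + (n - m) % (q + 1))
  map_add' f g := by ext n; simp only [Pi.add_apply]; ring
  map_smul' r f := by ext n; simp only [Pi.smul_apply, smul_eq_mul, RingHom.id_apply]; ring

theorem isQuasiPeriodic_quasiExt {ζ : ℂ} (hζ : ζ ≠ 0) (m : ℤ) (g : ℤ → ℂ) :
    IsQuasiPeriodic q ζ (quasiExt q ζ m g) := by
  intro n
  change ζ ^ ((n + (q + 1) - m) / ((q : ℤ) + 1)) * g (m + (n + (q + 1) - m) % (q + 1)) =
    ζ * (ζ ^ ((n - m) / ((q : ℤ) + 1)) * g (m + (n - m) % (q + 1)))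
  have h : n + (q + 1 : ℤ) - m = n - m + (q + 1) := by ring
  rw [h, Int.add_emod_right, Int.add_ediv_of_dvd_right (dvd_refl _),
    Int.ediv_self (by positivity), zpow_add_one₀ hζ]
  ring

theorem quasiExt_apply_of_mem (ζ : ℂ) {m n : ℤ} (g : ℤ → ℂ) (h1 : m ≤ n) (h2 : n < m + (q + 1)) :
    quasiExt q ζ m g n = g n := by
  change ζ ^ ((n - m) / ((q : ℤ) + 1)) * g (m + (n - m) % (q + 1)) = g n
  rw [Int.ediv_eq_zero_of_lt (by omega) (by omega), Int.emod_eq_of_lt (by omega) (by omega)]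
  simp

theorem IsQuasiPeriodic.quasiExt_eq {ζ : ℂ} (hζ : ζ ≠ 0) {v g : ℤ → ℂ}
    (hv : IsQuasiPeriodic q ζ v) (m : ℤ) (h : ∀ n, m ≤ n → n < m + (q + 1) → g n = v n) :
    quasiExt q ζ m g = v := by
  ext n
  change ζ ^ ((n - m) / ((q : ℤ) + 1)) * g (m + (n - m) % (q + 1)) = v n
  have hq : (0 : ℤ) < q + 1 := by positivity
  have h0 := Int.emod_nonneg (n - m) hq.ne'
  have h1 := Int.emod_lt_of_pos (n - m) hq
  rw [h _ (by omega) (by omega), ← hv.eq_zpow_mul hζ]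
  congr 1
  have := Int.emod_add_mul_ediv (n - m) (q + 1)
  linear_combination this

theorem sum_range_eq_of_periodic {M : Type*} [AddCommGroup M] {h : ℤ → M} {N : ℕ}
    (hh : ∀ n, h (n + N) = h n) (m : ℤ) :
    ∑ i ∈ Finset.range N, h (m + i) = ∑ i ∈ Finset.range N, h (0 + i) := by
  have hstep : ∀ m : ℤ, ∑ i ∈ Finset.range N, h (m + 1 + i) = ∑ i ∈ Finset.range N, h (m + i) := by
    intro m
    have h1 := Finset.sum_range_succ (fun i : ℕ => h (m + i)) N
    rw [Finset.sum_range_succ'] at h1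
    simp only [hh, Nat.cast_zero, add_zero, Nat.cast_add, Nat.cast_one] at h1
    rw [← add_right_cancel h1]
    exact Finset.sum_congr rfl fun i _ => by ring_nf
  induction m using Int.induction_on with
  | zero => rfl
  | succ r ih => rw [hstep, ih]
  | pred r ih => rw [← hstep, sub_add_cancel, ih]

theorem IsQuasiPeriodic.inner_restrict_eq {ζ : ℂ} (hζ : ‖ζ‖ = 1) {v w : ℤ → ℂ}
    (hv : IsQuasiPeriodic q ζ v) (hw : IsQuasiPeriodic q ζ w) (m : ℤ) :
    ⟪restrict (q + 1) 0 v, restrict (q + 1) 0 w⟫_ℂ =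
      ⟪restrict (q + 1) m v, restrict (q + 1) m w⟫_ℂ := by
  rw [inner_restrict, inner_restrict]
  refine (sum_range_eq_of_periodic (h := fun n => conj (v n) * w n) (fun n => ?_) m).symm
  push_cast
  rw [hv, hw, map_mul]
  have : conj ζ * ζ = 1 := by rw [Complex.conj_mul', hζ]; norm_num
  linear_combination (conj (v n) * w n) * this

/-- The fibre of a periodic Jacobi operator at the Floquet multiplier `ζ`. -/
noncomputable def fiber (a e : ℤ → ℝ) (q : ℕ) (ζ : ℂ) :
    EuclideanSpace ℂ (Fin (q + 1)) →ₗ[ℂ] EuclideanSpace ℂ (Fin (q + 1)) :=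
  restrict (q + 1) 0 ∘ₗ jacobi a e ∘ₗ quasiExt q ζ 0 ∘ₗ zeroExt 0

theorem fiber_restrict (a e : ℤ → ℝ) {ζ : ℂ} (hζ : ζ ≠ 0) {v : ℤ → ℂ}
    (hv : IsQuasiPeriodic q ζ v) :
    fiber a e q ζ (restrict (q + 1) 0 v) = restrict (q + 1) 0 (jacobi a e v) := by
  have : quasiExt q ζ 0 (zeroExt 0 (restrict (q + 1) 0 v)) = v := by
    refine hv.quasiExt_eq hζ 0 fun n h0 h1 => ?_
    obtain ⟨i, rfl⟩ := Int.eq_ofNat_of_zero_le h0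
    have := zeroExt_apply_add 0 (restrict (q + 1) 0 v) ⟨i, by omega⟩
    simp only [restrict_apply, zero_add] at this
    exact this
  change restrict (q + 1) 0 (jacobi a e (quasiExt q ζ 0 (zeroExt 0 (restrict (q + 1) 0 v)))) = _
  rw [this]

theorem exists_isQuasiPeriodic_restrict_eq {ζ : ℂ} (hζ : ζ ≠ 0)
    (f : EuclideanSpace ℂ (Fin (q + 1))) :
    ∃ v, IsQuasiPeriodic q ζ v ∧ restrict (q + 1) 0 v = f := by
  refine ⟨_, isQuasiPeriodic_quasiExt hζ 0 (zeroExt 0 f), ?_⟩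
  ext i
  have := i.2
  rw [restrict_apply, quasiExt_apply_of_mem _ _ (by omega) (by omega), zeroExt_apply_add]

theorem fiber_isSymmetric {a e : ℤ → ℝ} (he : ∀ n, e (n + (q + 1)) = e n) {ζ : ℂ}
    (hζ : ‖ζ‖ = 1) : (fiber a e q ζ).IsSymmetric := by
  have hζ0 : ζ ≠ 0 := fun h => by simp [h] at hζ
  intro f g
  obtain ⟨v, hv, rfl⟩ := exists_isQuasiPeriodic_restrict_eq hζ0 f
  obtain ⟨w, hw, rfl⟩ := exists_isQuasiPeriodic_restrict_eq hζ0 g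
  rw [fiber_restrict a e hζ0 hv, fiber_restrict a e hζ0 hw, inner_restrict, inner_restrict,
    ← sub_eq_zero, sum_jacobi_green, sub_eq_zero, jacobiBoundary, jacobiBoundary]
  push_cast
  have h : (0 : ℤ) + (q + 1) - 1 = -1 + (q + 1) := by ring
  rw [h, hv, hw, hv, hw, he, map_mul, map_mul]
  have : conj ζ * ζ = 1 := by rw [Complex.conj_mul', hζ]; norm_num
  linear_combination (-(e 0 : ℂ) * (conj (v (-1)) * w 0 - conj (v 0) * w (-1))) * this

/-- The embedding of the Dirichlet problem on `m + 1, …, m + q` into the fibre at `ζ`. -/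
noncomputable def dirichletEmbedding (q : ℕ) (ζ : ℂ) (m : ℤ) :
    EuclideanSpace ℂ (Fin q) →ₗ[ℂ] EuclideanSpace ℂ (Fin (q + 1)) :=
  restrict (q + 1) 0 ∘ₗ quasiExt q ζ m ∘ₗ zeroExt (m + 1)

theorem quasiExt_zeroExt_apply {ζ : ℂ} (hζ : ζ ≠ 0) (m : ℤ) (f : EuclideanSpace ℂ (Fin q)) {n : ℤ}
    (h1 : m ≤ n) (h2 : n ≤ m + (q + 1)) :
    quasiExt q ζ m (zeroExt (m + 1) f) n = zeroExt (m + 1) f n := by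
  rcases h2.lt_or_eq with h2 | rfl
  · exact quasiExt_apply_of_mem ζ _ h1 h2
  · rw [isQuasiPeriodic_quasiExt hζ, quasiExt_apply_of_mem ζ _ le_rfl (by omega),
      zeroExt_apply_of_notMem (m + 1) f (by omega), zeroExt_apply_of_notMem (m + 1) f (by omega),
      mul_zero]

theorem inner_restrict_succ (m : ℤ) (v w : ℤ → ℂ) (hw : w m = 0) :
    ⟪restrict (q + 1) m v, restrict (q + 1) m w⟫_ℂ =
      ⟪restrict q (m + 1) v, restrict q (m + 1) w⟫_ℂ := by
  rw [inner_restrict, inner_restrict, Finset.sum_range_succ']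
  simp only [Nat.cast_zero, add_zero, hw, mul_zero, Nat.cast_add, Nat.cast_one]
  exact Finset.sum_congr rfl fun i _ => by ring_nf

theorem inner_fiber_dirichletEmbedding {a e : ℤ → ℝ} (ha : ∀ n, a (n + (q + 1)) = a n)
    (he : ∀ n, e (n + (q + 1)) = e n) {ζ : ℂ} (hζ : ‖ζ‖ = 1) (m : ℤ)
    (f : EuclideanSpace ℂ (Fin q)) :
    ⟪fiber a e q ζ (dirichletEmbedding q ζ m f), dirichletEmbedding q ζ m f⟫_ℂ =
      ⟪dirichlet a e q (m + 1) f, f⟫_ℂ := by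
  have hζ0 : ζ ≠ 0 := fun h => by simp [h] at hζ
  have hF := isQuasiPeriodic_quasiExt (q := q) hζ0 m (zeroExt (m + 1) f)
  change ⟪fiber a e q ζ (restrict (q + 1) 0 (quasiExt q ζ m (zeroExt (m + 1) f))),
    restrict (q + 1) 0 (quasiExt q ζ m (zeroExt (m + 1) f))⟫_ℂ = _
  rw [fiber_restrict a e hζ0 hF, (hF.jacobi ha he).inner_restrict_eq hζ hF m,
    inner_restrict_succ]
  · rw [dirichlet_apply]
    conv_rhs => rw [← restrict_zeroExt (m + 1) f]
    rw [restrict_zeroExt]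
    congr 1
    · ext i
      have := i.2
      rw [restrict_apply, restrict_apply, jacobi_apply, jacobi_apply,
        quasiExt_zeroExt_apply hζ0 _ _ (by omega) (by omega),
        quasiExt_zeroExt_apply hζ0 _ _ (by omega) (by omega),
        quasiExt_zeroExt_apply hζ0 _ _ (by omega) (by omega)]
    · ext i
      have := i.2
      rw [restrict_apply, quasiExt_zeroExt_apply hζ0 _ _ (by omega) (by omega), zeroExt_apply_add]
  · rw [quasiExt_zeroExt_apply hζ0 _ _ le_rfl (by omega),
      zeroExt_apply_of_notMem _ _ (by omega)]

theorem norm_dirichletEmbedding {ζ : ℂ} (hζ : ‖ζ‖ = 1) (m : ℤ) (f : EuclideanSpace ℂ (Fin q)) :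
    ‖dirichletEmbedding q ζ m f‖ = ‖f‖ := by
  have hζ0 : ζ ≠ 0 := fun h => by simp [h] at hζ
  have hF := isQuasiPeriodic_quasiExt (q := q) hζ0 m (zeroExt (m + 1) f)
  have h : ⟪dirichletEmbedding q ζ m f, dirichletEmbedding q ζ m f⟫_ℂ = ⟪f, f⟫_ℂ := by
    change ⟪restrict (q + 1) 0 (quasiExt q ζ m (zeroExt (m + 1) f)),
      restrict (q + 1) 0 (quasiExt q ζ m (zeroExt (m + 1) f))⟫_ℂ = _
    rw [hF.inner_restrict_eq hζ hF m, inner_restrict_succ]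
    · have : restrict q (m + 1) (quasiExt q ζ m (zeroExt (m + 1) f)) = f := by
        ext i
        have := i.2
        rw [restrict_apply, quasiExt_zeroExt_apply hζ0 _ _ (by omega) (by omega),
          zeroExt_apply_add]
      rw [this]
    · rw [quasiExt_zeroExt_apply hζ0 _ _ le_rfl (by omega),
        zeroExt_apply_of_notMem _ _ (by omega)]
  rw [inner_self_eq_norm_sq_to_K, inner_self_eq_norm_sq_to_K] at h
  norm_cast at h
  exact (sq_eq_sq₀ (norm_nonneg _) (norm_nonneg _)).mp (by exact_mod_cast h)

/-- Between the `k`-th Dirichlet eigenvalues attached to two sites, every fibre of a periodic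
Jacobi operator is uniformly bounded below. -/
theorem norm_restrict_le_of_between {a e : ℤ → ℝ} (ha : ∀ n, a (n + (q + 1)) = a n)
    (he : ∀ n, e (n + (q + 1)) = e n) (m l : ℤ) (k : Fin q) {s c : ℝ} (hc : 0 < c)
    (hl : (dirichlet_isSymmetric a e q (l + 1)).eigenvalues finrank_euclideanSpace_fin k ≤ s - c)
    (hm : s + c ≤ (dirichlet_isSymmetric a e q (m + 1)).eigenvalues finrank_euclideanSpace_fin k)
    {ζ : ℂ} (hζ : ‖ζ‖ = 1) {v : ℤ → ℂ} (hv : IsQuasiPeriodic q ζ v) :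
    c * ‖restrict (q + 1) 0 v‖ ≤
      2 * ‖restrict (q + 1) 0 (jacobi a e v - (s : ℂ) • v)‖ := by
  have hζ0 : ζ ≠ 0 := fun h => by simp [h] at hζ
  obtain ⟨E, hEdim, hE, -⟩ := exists_submodule_of_eigenvalues
    (dirichlet_isSymmetric a e q (m + 1)) finrank_euclideanSpace_fin (Finset.Iic k)
  obtain ⟨F, hFdim, -, hF⟩ := exists_submodule_of_eigenvalues
    (dirichlet_isSymmetric a e q (l + 1)) finrank_euclideanSpace_fin (Finset.Ici k)
  have hinj : ∀ m, Function.Injective (dirichletEmbedding q ζ m) := fun m =>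
    (injective_iff_map_eq_zero _).mpr fun f hf => by
      rw [← norm_eq_zero, ← norm_dirichletEmbedding hζ m, hf, norm_zero]
  have hdim : ∀ (m : ℤ) (G : Submodule ℂ (EuclideanSpace ℂ (Fin q))),
      Module.finrank ℂ (G.map (dirichletEmbedding q ζ m)) = Module.finrank ℂ G := fun m G =>
    ((Submodule.equivMapOfInjective _ (hinj m) G).finrank_eq).symm
  rw [map_sub, map_smul, ← fiber_restrict a e hζ0 hv]
  refine norm_le_of_definite_subspaces (fiber_isSymmetric he hζ) hc
    (E.map (dirichletEmbedding q ζ m)) (F.map (dirichletEmbedding q ζ l)) ?_ ?_ ?_ _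
  · rw [hdim, hdim, hEdim, hFdim, Fin.card_Iic, Fin.card_Ici, finrank_euclideanSpace_fin]
    have := k.2
    omega
  · rintro _ ⟨f, hf, rfl⟩
    rw [inner_fiber_dirichletEmbedding ha he hζ, norm_dirichletEmbedding hζ]
    exact hE _ (fun i hi => hm.trans
      ((dirichlet_isSymmetric a e q (m + 1)).eigenvalues_antitone _ (Finset.mem_Iic.mp hi))) f hf
  · rintro _ ⟨f, hf, rfl⟩
    rw [inner_fiber_dirichletEmbedding ha he hζ, norm_dirichletEmbedding hζ]
    exact hF _ (fun i hi => ((dirichlet_isSymmetric a e q (l + 1)).eigenvalues_antitone _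
      (Finset.mem_Ici.mp hi)).trans hl) f hf

end Jacobi

section Floquet

open ComplexConjugate

theorem sum_conj_mul_pow_eq {N : ℕ} {ω : ℂ} (hω : IsPrimitiveRoot ω N) {r s : ℕ}
    (hr : r < N) (hs : s < N) :
    ∑ k ∈ Finset.range N, (conj (ω ^ r) * ω ^ s) ^ k = if r = s then (N : ℂ) else 0 := by
  have hnorm : ‖ω‖ = 1 := hω.norm'_eq_one (by omega)
  have hconj : ω ^ r * conj (ω ^ r) = 1 := by
    rw [Complex.mul_conj', norm_pow, hnorm]
    norm_num
  split_ifs with h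
  · subst h
    rw [mul_comm (conj (ω ^ r)), hconj]
    simp
  · have hne : conj (ω ^ r) * ω ^ s - 1 ≠ 0 := by
      intro h0
      refine h (hω.pow_inj hr hs ?_)
      linear_combination (-ω ^ r) * h0 + ω ^ s * hconj
    refine (mul_eq_zero.mp ?_).resolve_left hne
    rw [mul_geom_sum, mul_pow, ← map_pow, pow_right_comm ω r N, pow_right_comm ω s N,
      hω.pow_eq_one]
    simp

/-- Parseval's identity for the finite Fourier transform of order `N`. -/
theorem sum_norm_sq_sum_mul_pow {N : ℕ} {ω : ℂ} (hω : IsPrimitiveRoot ω N) (c : ℕ → ℂ) :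
    ∑ k ∈ Finset.range N, ‖∑ r ∈ Finset.range N, (ω ^ k) ^ r * c r‖ ^ 2 =
      N * ∑ r ∈ Finset.range N, ‖c r‖ ^ 2 := by
  suffices h : ∑ k ∈ Finset.range N, (conj (∑ r ∈ Finset.range N, (ω ^ k) ^ r * c r) *
      ∑ r ∈ Finset.range N, (ω ^ k) ^ r * c r) =
      N * ∑ r ∈ Finset.range N, conj (c r) * c r by
    simp only [Complex.conj_mul'] at h
    exact_mod_cast h
  calc
    _ = ∑ k ∈ Finset.range N, ∑ r ∈ Finset.range N, ∑ s ∈ Finset.range N,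
          conj (c r) * c s * (conj (ω ^ r) * ω ^ s) ^ k := by
      refine Finset.sum_congr rfl fun k _ => ?_
      rw [map_sum, Finset.sum_mul_sum]
      refine Finset.sum_congr rfl fun r _ => Finset.sum_congr rfl fun s _ => ?_
      simp only [map_mul, map_pow]
      ring
    _ = ∑ r ∈ Finset.range N, ∑ s ∈ Finset.range N,
          conj (c r) * c s * ∑ k ∈ Finset.range N, (conj (ω ^ r) * ω ^ s) ^ k := by
      rw [Finset.sum_comm]
      refine Finset.sum_congr rfl fun r _ => ?_
      rw [Finset.sum_comm]
      exact Finset.sum_congr rfl fun s _ => by rw [Finset.mul_sum]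
    _ = _ := by
      rw [Finset.mul_sum]
      refine Finset.sum_congr rfl fun r hr => ?_
      rw [Finset.sum_eq_single r]
      · rw [sum_conj_mul_pow_eq hω (Finset.mem_range.mp hr) (Finset.mem_range.mp hr), if_pos rfl,
          mul_comm]
      · intro s hs hsr
        rw [sum_conj_mul_pow_eq hω (Finset.mem_range.mp hr) (Finset.mem_range.mp hs),
          if_neg hsr.symm, mul_zero]
      · intro h
        exact absurd hr h

variable {q : ℕ}

/-- The Floquet transform, over `N` periods of length `q + 1`, of a sequence at `η`. -/
noncomputable def floquet (q N : ℕ) (η : ℂ) (u : ℤ → ℂ) (n : ℤ) : ℂ :=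
  ∑ r ∈ Finset.range N, η ^ r * u (n + r * (q + 1))

theorem isQuasiPeriodic_floquet {N : ℕ} {η : ℂ} (hη : η ≠ 0) (hN : η ^ N = 1) {u : ℤ → ℂ}
    (hu : ∀ n : ℤ, u (n + N * (q + 1)) = u n) : IsQuasiPeriodic q η⁻¹ (floquet q N η u) := by
  intro n
  rw [eq_inv_mul_iff_mul_eq₀ hη, floquet, floquet, Finset.mul_sum]
  have h := (Finset.sum_range_succ' (fun r : ℕ => η ^ r * u (n + r * (q + 1))) N).symm.trans
    (Finset.sum_range_succ (fun r : ℕ => η ^ r * u (n + r * (q + 1))) N)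
  rw [hN, hu] at h
  simp only [Nat.cast_zero, zero_mul, add_zero, pow_zero, add_left_inj] at h
  rw [← h]
  refine Finset.sum_congr rfl fun r _ => ?_
  have : n + (q + 1 : ℤ) + r * (q + 1) = n + ((r + 1 : ℕ) : ℤ) * (q + 1) := by push_cast; ring
  rw [this]
  ring

theorem floquet_jacobi {a e : ℤ → ℝ} (ha : ∀ n, a (n + (q + 1)) = a n)
    (he : ∀ n, e (n + (q + 1)) = e n) (N : ℕ) (η s : ℂ) (u : ℤ → ℂ) :
    floquet q N η (jacobi a e u - s • u) =
      jacobi a e (floquet q N η u) - s • floquet q N η u := by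
  ext n
  simp only [floquet, jacobi_apply, Pi.sub_apply, Pi.smul_apply, smul_eq_mul, Finset.mul_sum,
    ← Finset.sum_add_distrib, ← Finset.sum_sub_distrib]
  refine Finset.sum_congr rfl fun r _ => ?_
  have ha' : a (n + r * (q + 1)) = a n := Function.Periodic.nat_mul (f := a) ha r n
  have he' : ∀ n, e (n + r * (q + 1)) = e n := Function.Periodic.nat_mul (f := e) he r
  have h1 : n + (r * (q + 1) : ℤ) - 1 = n - 1 + r * (q + 1) := by ring
  have h2 : n + (r * (q + 1) : ℤ) + 1 = n + 1 + r * (q + 1) := by ring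
  rw [h1, h2, ha', he', he']
  ring

theorem sum_range_mul_eq {M : Type*} [AddCommMonoid M] (h : ℤ → M) (P N : ℕ) :
    ∑ n ∈ Finset.range (N * P), h n =
      ∑ r ∈ Finset.range N, ∑ i ∈ Finset.range P, h (i + r * P) := by
  induction N with
  | zero => simp
  | succ N ih =>
    rw [Finset.sum_range_succ, ← ih, Nat.succ_mul, Finset.sum_range_add]
    congr 1
    refine Finset.sum_congr rfl fun i _ => ?_
    push_cast
    rw [add_comm]

theorem sum_norm_sq_restrict_floquet {N : ℕ} {ω : ℂ} (hω : IsPrimitiveRoot ω N) (u : ℤ → ℂ) :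
    ∑ k ∈ Finset.range N, ‖restrict (q + 1) 0 (floquet q N (ω ^ k) u)‖ ^ 2 =
      N * ∑ n ∈ Finset.range (N * (q + 1)), ‖u n‖ ^ 2 := by
  rw [sum_range_mul_eq (fun n => ‖u n‖ ^ 2)]
  simp only [norm_sq_restrict]
  rw [Finset.sum_comm, Finset.sum_comm (s := Finset.range N), Finset.mul_sum]
  refine Finset.sum_congr rfl fun i _ => ?_
  rw [← sum_norm_sq_sum_mul_pow hω]
  refine Finset.sum_congr rfl fun k _ => ?_
  rw [floquet, zero_add]
  push_cast
  rfl

theorem sum_norm_sq_le_of_between {a e : ℤ → ℝ} (ha : ∀ n, a (n + (q + 1)) = a n)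
    (he : ∀ n, e (n + (q + 1)) = e n) (m l : ℤ) (k : Fin q) {s c : ℝ} (hc : 0 < c)
    (hl : (dirichlet_isSymmetric a e q (l + 1)).eigenvalues finrank_euclideanSpace_fin k ≤ s - c)
    (hm : s + c ≤ (dirichlet_isSymmetric a e q (m + 1)).eigenvalues finrank_euclideanSpace_fin k)
    {N : ℕ} (hN : N ≠ 0) {u : ℤ → ℂ} (hu : ∀ n : ℤ, u (n + N * (q + 1)) = u n) :
    c ^ 2 * ∑ n ∈ Finset.range (N * (q + 1)), ‖u n‖ ^ 2 ≤
      4 * ∑ n ∈ Finset.range (N * (q + 1)), ‖(jacobi a e u - (s : ℂ) • u) n‖ ^ 2 := by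
  have hω := Complex.isPrimitiveRoot_exp N hN
  set ω := Complex.exp (2 * Real.pi * Complex.I / N)
  have hnorm : ‖ω‖ = 1 := hω.norm'_eq_one hN
  have hpos : (0 : ℝ) < N := by positivity
  refine le_of_mul_le_mul_left ?_ hpos
  rw [mul_left_comm, mul_left_comm (N : ℝ) 4, ← sum_norm_sq_restrict_floquet hω,
    ← sum_norm_sq_restrict_floquet hω, Finset.mul_sum, Finset.mul_sum]
  refine Finset.sum_le_sum fun j _ => ?_
  have hq := isQuasiPeriodic_floquet (q := q) (pow_ne_zero j (hω.ne_zero hN))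
    (by rw [pow_right_comm, hω.pow_eq_one, one_pow]) hu
  have h := norm_restrict_le_of_between ha he m l k hc hl hm (by simp [hnorm]) hq
  rw [floquet_jacobi ha he]
  have h2 := pow_le_pow_left₀ (by positivity) h 2
  rw [mul_pow, mul_pow] at h2
  linarith

theorem sum_norm_sq_le_of_between_of_support {a e : ℤ → ℝ} (ha : ∀ n, a (n + (q + 1)) = a n)
    (he : ∀ n, e (n + (q + 1)) = e n) (m l : ℤ) (k : Fin q) {s c : ℝ} (hc : 0 < c)
    (hl : (dirichlet_isSymmetric a e q (l + 1)).eigenvalues finrank_euclideanSpace_fin k ≤ s - c)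
    (hm : s + c ≤ (dirichlet_isSymmetric a e q (m + 1)).eigenvalues finrank_euclideanSpace_fin k)
    {N : ℕ} (hN : N ≠ 0) {d : ℤ} {u : ℤ → ℂ}
    (hu : ∀ n : ℤ, n ≤ d ∨ d + N * (q + 1) - 1 ≤ n → u n = 0) :
    c ^ 2 * ∑ i ∈ Finset.range (N * (q + 1)), ‖u (d + i)‖ ^ 2 ≤
      4 * ∑ i ∈ Finset.range (N * (q + 1)), ‖(jacobi a e u - (s : ℂ) • u) (d + i)‖ ^ 2 := by
  obtain ⟨Q, hQ⟩ : ∃ Q, N * (q + 1) = Q + 1 := Nat.exists_eq_succ_of_ne_zero (by positivity)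
  have hQ' : (N : ℤ) * (q + 1) = Q + 1 := by exact_mod_cast hQ
  rw [hQ'] at hu
  have hper := isQuasiPeriodic_quasiExt (q := Q) one_ne_zero d u
  have hperN : ∀ n : ℤ, quasiExt Q 1 d u (n + N * (q + 1)) = quasiExt Q 1 d u n := fun n => by
    rw [hQ', hper, one_mul]
  have hmid : ∀ n, d ≤ n → n < d + (Q + 1) → quasiExt Q 1 d u n = u n := fun n h1 h2 =>
    quasiExt_apply_of_mem 1 u h1 h2
  have heq : ∀ n, d - 1 ≤ n → n ≤ d + (Q + 1) → quasiExt Q 1 d u n = u n := by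
    intro n h1 h2
    rcases h1.eq_or_lt with rfl | h1
    · have := hper (d - 1)
      rw [one_mul, hmid _ (by omega) (by omega), hu _ (by omega)] at this
      rw [← this, hu _ (by omega)]
    rcases h2.eq_or_lt with rfl | h2
    · rw [hper, hmid _ le_rfl (by omega), hu _ (by omega), hu _ (by omega), mul_zero]
    · exact hmid n (by omega) h2
  have h := sum_norm_sq_le_of_between ha he m l k hc hl hm hN hperN
  have hshift : ∀ g : ℤ → ℂ, (∀ n : ℤ, g (n + N * (q + 1)) = g n) →
      ∑ n ∈ Finset.range (N * (q + 1)), ‖g n‖ ^ 2 =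
        ∑ i ∈ Finset.range (N * (q + 1)), ‖g (d + i)‖ ^ 2 := by
    intro g hg
    have := sum_range_eq_of_periodic (h := fun n => ‖g n‖ ^ 2) (N := N * (q + 1))
      (fun n => by push_cast; rw [hg]) d
    simpa using this.symm
  rw [hshift _ hperN, hshift] at h
  · convert h using 4 with i hi i hi
    · rw [Finset.mem_range] at hi
      rw [heq _ (by omega) (by omega)]
    · rw [Finset.mem_range] at hi
      simp only [Pi.sub_apply, Pi.smul_apply, jacobi_apply]
      rw [heq _ (by omega) (by omega), heq _ (by omega) (by omega), heq _ (by omega) (by omega)]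
  · intro n
    have ha' : a (n + N * (q + 1)) = a n := Function.Periodic.nat_mul (f := a) ha N n
    have he' : ∀ n, e (n + N * (q + 1)) = e n := Function.Periodic.nat_mul (f := e) he N
    have h1 : n + (N * (q + 1) : ℤ) - 1 = n - 1 + N * (q + 1) := by ring
    have h2 : n + (N * (q + 1) : ℤ) + 1 = n + 1 + N * (q + 1) := by ring
    simp only [Pi.sub_apply, Pi.smul_apply, jacobi_apply]
    rw [h1, h2, ha', he', he', hperN, hperN, hperN]

end Floquet

section SquareSummable

open ComplexConjugate

variable {q : ℕ}

local notation "ℓ²" => lp (fun _ : ℤ => ℂ) 2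

theorem lp_inner_eq_inner_restrict {N : ℕ} {d : ℤ} {w : ℓ²}
    (hw : ∀ n : ℤ, n < d ∨ d + N ≤ n → w n = 0) (v : ℓ²) :
    ⟪v, w⟫_ℂ = ⟪restrict N d v, restrict N d w⟫_ℂ := by
  rw [lp.inner_eq_tsum, inner_restrict,
    tsum_eq_sum (s := (Finset.range N).image fun i : ℕ => d + (i : ℤ)), Finset.sum_image]
  · refine Finset.sum_congr rfl fun i _ => ?_
    rw [RCLike.inner_apply, mul_comm]
  · intro i _ j _ h
    simpa using h
  · intro n hn
    rw [hw n, inner_zero_right]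
    by_contra! h
    refine hn (Finset.mem_image.mpr ⟨(n - d).toNat, Finset.mem_range.mpr ?_, ?_⟩) <;> omega

theorem lp_norm_sq_eq {N : ℕ} {d : ℤ} {w : ℓ²} (hw : ∀ n : ℤ, n < d ∨ d + N ≤ n → w n = 0) :
    ‖w‖ ^ 2 = ∑ i ∈ Finset.range N, ‖w (d + i)‖ ^ 2 := by
  rw [← norm_sq_restrict, ← inner_self_eq_norm_sq (𝕜 := ℂ), ← inner_self_eq_norm_sq (𝕜 := ℂ),
    lp_inner_eq_inner_restrict hw]

/-- A closed property of `ℓ²(ℤ)` holds everywhere as soon as it holds for finitely supported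
sequences. -/
theorem lp_closed_induction {P : ℓ² → Prop} (hP : IsClosed {u | P u})
    (h : ∀ (K : ℕ) (u : ℓ²), (∀ n : ℤ, K ≤ n.natAbs → u n = 0) → P u) (u : ℓ²) : P u := by
  refine hP.mem_of_tendsto (lp.hasSum_single (by simp) u) (Eventually.of_forall fun S => ?_)
  refine h (S.sup Int.natAbs + 1) _ fun n hn => ?_
  rw [lp.coeFn_sum, Finset.sum_apply]
  refine Finset.sum_eq_zero fun i hi => lp.single_apply_ne 2 i _ ?_
  rintro rfl
  have := Finset.le_sup (f := Int.natAbs) hi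
  omega

theorem isSelfAdjoint_of_forall_apply_eq_jacobi {a e : ℤ → ℝ} {T : ℓ² →L[ℂ] ℓ²}
    (hT : ∀ u n, T u n = jacobi a e u n) : IsSelfAdjoint T := by
  rw [ContinuousLinearMap.isSelfAdjoint_iff_isSymmetric]
  intro v w
  refine lp_closed_induction (P := fun w => ⟪T v, w⟫_ℂ = ⟪v, T w⟫_ℂ)
    (isClosed_eq (by fun_prop) (by fun_prop)) (fun K w hw => ?_) w
  have hw' : ∀ n : ℤ, n < -K ∨ K < n → w n = 0 := fun n hn => hw n (by omega)
  have hTu : ∀ u : ℓ², (T u : ℤ → ℂ) = jacobi a e u := fun u => funext (hT u)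
  rw [lp_inner_eq_inner_restrict (N := 2 * K + 3) (d := -K - 1) (fun n hn => hw' n (by omega)),
    lp_inner_eq_inner_restrict (N := 2 * K + 3) (d := -K - 1), inner_restrict, inner_restrict,
    hTu, hTu, ← sub_eq_zero, sum_jacobi_green, jacobiBoundary, jacobiBoundary,
    hw' _ (by omega), hw' _ (by omega), hw' _ (by omega), hw' _ (by omega)]
  · simp
  · intro n hn
    rw [hT, jacobi_apply, hw' _ (by omega), hw' _ (by omega), hw' _ (by omega)]
    simp

theorem isUnit_of_isSelfAdjoint_of_bound {H : Type*} [NormedAddCommGroup H]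
    [InnerProductSpace ℂ H] [CompleteSpace H] {S : H →L[ℂ] H} (hS : IsSelfAdjoint S) {c : ℝ}
    (hc : 0 < c) (h : ∀ x, c * ‖x‖ ≤ ‖S x‖) : IsUnit S := by
  have hSS : IsUnit (S * S) := by
    refine ContinuousLinearMap.isUnit_of_forall_le_norm_inner_map _
      (c := ⟨c ^ 2, by positivity⟩) (by change 0 < c ^ 2; positivity) fun x => ?_
    have hsymm := (ContinuousLinearMap.isSelfAdjoint_iff_isSymmetric.mp hS) (S x) x
    change ‖x‖ ^ 2 * c ^ 2 ≤ ‖⟪S (S x), x⟫_ℂ‖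
    refine le_trans ?_ (RCLike.re_le_norm _)
    rw [show ⟪S (S x), x⟫_ℂ = ⟪S x, S x⟫_ℂ from hsymm, inner_self_eq_norm_sq, ← mul_pow, mul_comm]
    exact pow_le_pow_left₀ (by positivity) (h x) 2
  exact ((Commute.refl S).isUnit_mul_iff.mp hSS).1

/-- The interval between the `k`-th Dirichlet eigenvalues attached to two sites lies in the
resolvent set of a periodic Jacobi operator. -/
theorem notMem_spectrum_of_between {a e : ℤ → ℝ} (ha : ∀ n, a (n + (q + 1)) = a n)
    (he : ∀ n, e (n + (q + 1)) = e n) {T : ℓ² →L[ℂ] ℓ²} (hT : ∀ u n, T u n = jacobi a e u n)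
    (m l : ℤ) (k : Fin q) {s : ℝ}
    (hl : (dirichlet_isSymmetric a e q (l + 1)).eigenvalues finrank_euclideanSpace_fin k < s)
    (hm : s < (dirichlet_isSymmetric a e q (m + 1)).eigenvalues finrank_euclideanSpace_fin k) :
    (s : ℂ) ∉ spectrum ℂ T := by
  set α := (dirichlet_isSymmetric a e q (l + 1)).eigenvalues finrank_euclideanSpace_fin k with hα
  set β := (dirichlet_isSymmetric a e q (m + 1)).eigenvalues finrank_euclideanSpace_fin k with hβ
  set c := min (s - α) (β - s) with hc_def
  have hc : 0 < c := lt_min (by linarith) (by linarith)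
  have hTsa := isSelfAdjoint_of_forall_apply_eq_jacobi hT
  have hbound : ∀ u : ℓ², c * ‖u‖ ≤ 2 * ‖T u - (s : ℂ) • u‖ := by
    refine lp_closed_induction (isClosed_le (by fun_prop) (by fun_prop)) fun K u hu => ?_
    have hu' : ∀ n : ℤ, n ≤ -(K + 1 : ℤ) ∨ -(K + 1 : ℤ) + (2 * K + 3 : ℕ) * (q + 1) - 1 ≤ n →
        (u : ℤ → ℂ) n = 0 := by
      intro n hn
      refine hu n ?_
      have : ((2 * K + 3 : ℕ) : ℤ) ≤ (2 * K + 3 : ℕ) * ((q : ℤ) + 1) :=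
        le_mul_of_one_le_right (by positivity) (by omega)
      omega
    have h := sum_norm_sq_le_of_between_of_support ha he m l k (s := s) hc
      (le_sub_comm.mp (min_le_left _ _)) (le_sub_iff_add_le'.mp (min_le_right _ _))
      (by omega) hu'
    have hJ : jacobi a e u - (s : ℂ) • (u : ℤ → ℂ) = (T u - (s : ℂ) • u : ℓ²) := by
      ext n
      rw [lp.coeFn_sub, Pi.sub_apply, Pi.sub_apply, hT]
      rfl
    rw [hJ, ← lp_norm_sq_eq, ← lp_norm_sq_eq] at h
    · refine (sq_le_sq₀ (by positivity) (by positivity)).mp ?_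
      rw [mul_pow, mul_pow]
      linarith
    · intro n hn
      push_cast at hn hu'
      rw [← hJ, Pi.sub_apply, Pi.smul_apply, jacobi_apply, hu' (n - 1) (by omega),
        hu' n (by omega), hu' (n + 1) (by omega)]
      simp
    · intro n hn
      push_cast at hn hu'
      exact hu' n (by omega)
  have hunit : IsUnit (T - algebraMap ℂ (ℓ² →L[ℂ] ℓ²) (s : ℂ)) := by
    refine isUnit_of_isSelfAdjoint_of_bound (c := c / 2) ?_ (by positivity) fun x => ?_
    · exact hTsa.sub (IsSelfAdjoint.algebraMap _ (Complex.conj_ofReal s))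
    · have := hbound x
      rw [sub_apply, Algebra.algebraMap_eq_smul_one,
        smul_apply, one_apply_eq_self]
      linarith
  rw [spectrum.mem_iff, not_not, ← neg_sub]
  exact hunit.neg

/-- The extension by zero of a finite vector, as an element of `ℓ²(ℤ)`. -/
noncomputable def zeroExtLp (d : ℤ) (f : EuclideanSpace ℂ (Fin q)) : ℓ² :=
  ∑ i : Fin q, lp.single 2 (d + (i : ℕ)) (f i)

theorem coe_zeroExtLp (d : ℤ) (f : EuclideanSpace ℂ (Fin q)) :
    (zeroExtLp d f : ℤ → ℂ) = zeroExt d f := by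
  ext n
  rw [zeroExtLp, lp.coeFn_sum, Finset.sum_apply]
  refine Finset.sum_congr rfl fun i _ => ?_
  rw [lp.single_apply, Pi.single_apply]

theorem zeroExtLp_apply_of_notMem (d : ℤ) (f : EuclideanSpace ℂ (Fin q)) (n : ℤ)
    (hn : n < d ∨ d + q ≤ n) : zeroExtLp d f n = 0 := by
  rw [coe_zeroExtLp, zeroExt_apply_of_notMem d f hn]

theorem norm_zeroExtLp (d : ℤ) (f : EuclideanSpace ℂ (Fin q)) : ‖zeroExtLp d f‖ = ‖f‖ := by
  rw [← sq_eq_sq₀ (norm_nonneg _) (norm_nonneg _),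
    lp_norm_sq_eq (zeroExtLp_apply_of_notMem d f), ← norm_sq_restrict, coe_zeroExtLp,
    restrict_zeroExt]

theorem inner_apply_zeroExtLp {a e : ℤ → ℝ} {T : ℓ² →L[ℂ] ℓ²}
    (hT : ∀ u n, T u n = jacobi a e u n) (d : ℤ) (f : EuclideanSpace ℂ (Fin q)) :
    ⟪T (zeroExtLp d f), zeroExtLp d f⟫_ℂ = ⟪dirichlet a e q d f, f⟫_ℂ := by
  have hTu : ∀ u : ℓ², (T u : ℤ → ℂ) = jacobi a e u := fun u => funext (hT u)
  rw [lp_inner_eq_inner_restrict (zeroExtLp_apply_of_notMem d f), hTu, coe_zeroExtLp,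
    restrict_zeroExt, dirichlet_apply]

/-- The weighted shift `u ↦ (c n * u (n + 1))`. -/
theorem exists_weightedShift {c : ℤ → ℝ} {M : ℝ} (hc : ∀ n, |c n| ≤ M) :
    ∃ R : ℓ² →L[ℂ] ℓ², (∀ u n, R u n = c n * u (n + 1)) ∧ ‖R‖ ≤ M := by
  have hM : 0 ≤ M := (abs_nonneg _).trans (hc 0)
  have hsum : ∀ (u : ℓ²) (S : Finset ℤ), ∑ n ∈ S, ‖(c n : ℂ) * u (n + 1)‖ ^ (2 : ENNReal).toReal ≤
      (M * ‖u‖) ^ (2 : ENNReal).toReal := by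
    intro u S
    calc
      _ ≤ ∑ n ∈ S, M ^ (2 : ENNReal).toReal * ‖u (n + 1)‖ ^ (2 : ENNReal).toReal := by
        refine Finset.sum_le_sum fun n _ => ?_
        rw [← Real.mul_rpow hM (norm_nonneg _), norm_mul, Complex.norm_real]
        exact Real.rpow_le_rpow (by positivity)
          (mul_le_mul_of_nonneg_right (hc n) (norm_nonneg _)) (by simp)
      _ = M ^ (2 : ENNReal).toReal *
          ∑ n ∈ S.map (Equiv.addRight (1 : ℤ)).toEmbedding, ‖u n‖ ^ (2 : ENNReal).toReal := by
        rw [Finset.sum_map, Finset.mul_sum]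
        rfl
      _ ≤ M ^ (2 : ENNReal).toReal * ‖u‖ ^ (2 : ENNReal).toReal := by
        gcongr
        exact lp.sum_rpow_le_norm_rpow (by simp) u _
      _ = _ := (Real.mul_rpow hM (norm_nonneg _)).symm
  let R : ℓ² →ₗ[ℂ] ℓ² :=
    { toFun := fun u => ⟨fun n => c n * u (n + 1), memℓp_gen' (hsum u)⟩
      map_add' := fun u v => by
        ext n
        exact mul_add _ _ _
      map_smul' := fun r u => by
        ext n
        exact mul_left_comm _ _ _ }
  have hR : ∀ u, ‖R u‖ ≤ M * ‖u‖ := fun u =>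
    lp.norm_le_of_forall_sum_le (by simp) (by positivity) (hsum u)
  exact ⟨R.mkContinuous M hR, fun _ _ => rfl, R.mkContinuous_norm_le hM hR⟩

theorem exists_re_inner_eq_eigenvalue {a e : ℤ → ℝ} {T : ℓ² →L[ℂ] ℓ²}
    (hT : ∀ u n, T u n = jacobi a e u n) (d : ℤ) (k : Fin q) :
    ∃ x : ℓ², x ≠ 0 ∧ (⟪T x, x⟫_ℂ).re =
      (dirichlet_isSymmetric a e q d).eigenvalues finrank_euclideanSpace_fin k * ‖x‖ ^ 2 := by
  set f := (dirichlet_isSymmetric a e q d).eigenvectorBasis finrank_euclideanSpace_fin k with hf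
  have hnorm : ‖f‖ = 1 := OrthonormalBasis.norm_eq_one _ k
  refine ⟨zeroExtLp d f, ?_, ?_⟩
  · rw [← norm_ne_zero_iff, norm_zeroExtLp, hnorm]
    exact one_ne_zero
  · rw [inner_apply_zeroExtLp hT, norm_zeroExtLp, hf, LinearMap.IsSymmetric.apply_eigenvectorBasis,
      inner_smul_left, RCLike.conj_ofReal]
    exact re_ofReal_mul_inner_self _ _

theorem sum_eigenvalues_dirichlet_sub {a e : ℤ → ℝ} (ha : ∀ n, a (n + (q + 1)) = a n) (i j : ℤ) :
    ∑ k, (dirichlet_isSymmetric a e q (i + 1)).eigenvalues finrank_euclideanSpace_fin k -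
      ∑ k, (dirichlet_isSymmetric a e q (j + 1)).eigenvalues finrank_euclideanSpace_fin k =
      a j - a i := by
  have hper : ∀ n : ℤ, a (n + (q + 1 : ℕ)) = a n := by
    push_cast
    exact ha
  have h : ∀ m : ℤ, ∑ r ∈ Finset.range q, a (m + 1 + r) =
      ∑ r ∈ Finset.range (q + 1), a (0 + r) - a m := by
    intro m
    rw [← sum_range_eq_of_periodic hper m, Finset.sum_range_succ']
    simp only [Nat.cast_zero, add_zero, add_sub_cancel_right, Nat.cast_add, Nat.cast_one]
    exact Finset.sum_congr rfl fun r _ => by ring_nf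
  rw [sum_eigenvalues_dirichlet, sum_eigenvalues_dirichlet, h, h]
  ring

theorem sub_le_of_isPathConnected_pseudospectrum {a e : ℤ → ℝ} (ha : ∀ n, a (n + (q + 1)) = a n)
    (he : ∀ n, e (n + (q + 1)) = e n) {A T : ℓ² →L[ℂ] ℓ²}
    (hT : ∀ u n, T u n = jacobi a e u n) {M ε : ℝ} (hM : ‖A - T‖ ≤ M) (hε : 0 < ε)
    (hconn : IsPathConnected (pseudospectrum ε A)) (i j : ℤ) :
    a j - a i ≤ 2 * (ε + M) * q := by
  by_contra! hlt
  have hM0 : 0 ≤ M := (norm_nonneg _).trans hM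
  obtain ⟨k, -, hk⟩ : ∃ k ∈ Finset.univ,
      (dirichlet_isSymmetric a e q (j + 1)).eigenvalues finrank_euclideanSpace_fin k +
        2 * (ε + M) <
      (dirichlet_isSymmetric a e q (i + 1)).eigenvalues finrank_euclideanSpace_fin k := by
    refine Finset.exists_lt_of_sum_lt ?_
    rw [Finset.sum_add_distrib, Finset.sum_const, Finset.card_univ, Fintype.card_fin, nsmul_eq_mul]
    linarith [sum_eigenvalues_dirichlet_sub (e := e) ha i j]
  obtain ⟨x, hx, hxα⟩ := exists_re_inner_eq_eigenvalue hT (j + 1) k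
  obtain ⟨y, hy, hyβ⟩ := exists_re_inner_eq_eigenvalue hT (i + 1) k
  have := gap_length_le (isSelfAdjoint_of_forall_apply_eq_jacobi hT) hM hε hconn
    (by linarith) (fun s hs => notMem_spectrum_of_between ha he hT i j k hs.1 hs.2) hx hy
    hxα.le hyβ.ge
  linarith

theorem abs_le_ciSup_of_periodic {p : ℕ} (hp : 0 < p) {c : ℤ → ℝ} (hc : ∀ n, c (n + p) = c n)
    (n : ℤ) : |c n| ≤ ⨆ i : Fin p, |c (i : ℕ)| := by
  have hp' : (0 : ℤ) < p := by exact_mod_cast hp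
  have h0 := Int.emod_nonneg n hp'.ne'
  have h1 := Int.emod_lt_of_pos n hp'
  have heq : c n = c (n % p) := by
    have := Function.Periodic.int_mul (f := c) hc (n / p) (n % p)
    rw [← this, Int.cast_id, mul_comm, Int.emod_add_mul_ediv]
  have hi : (((⟨(n % p).toNat, by omega⟩ : Fin p) : ℕ) : ℤ) = n % p := Int.toNat_of_nonneg h0
  rw [heq, ← hi]
  exact le_ciSup (f := fun i : Fin p => |c (i : ℕ)|) (Set.finite_range _).bddAbove _

end SquareSummable

theorem osc_le_of_pseudospectrum_pathConnected_firstOrder_discretization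
    (p : ℕ) (hp : 2 ≤ p) (a b : ℤ → ℝ)
    (ha : ∀ n : ℤ, a (n + p) = a n) (hb : ∀ n : ℤ, b (n + p) = b n)
    (A : lp (fun _ : ℤ => ℂ) 2 →L[ℂ] lp (fun _ : ℤ => ℂ) 2)
    (hA : ∀ u : lp (fun _ : ℤ => ℂ) 2, ∀ n : ℤ,
      A u n = -(b n : ℂ) * u (n - 1) + (a n : ℂ) * u n + (b n : ℂ) * u (n + 1))
    (ε : ℝ) (hε : 0 < ε) (hconn : IsPathConnected (pseudospectrum ε A)) :
    osc p a ≤ 2 * (ε + ⨆ i : Fin p, |b ((i : ℕ) : ℤ) + b (((i : ℕ) : ℤ) + 1)|) * ((p : ℝ) - 1) := by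
  obtain ⟨R, hR, hRnorm⟩ := exists_weightedShift (abs_le_ciSup_of_periodic (p := p) (by omega)
    (c := fun n => b n + b (n + 1)) fun n => by rw [hb, add_right_comm, hb])
  have hT : ∀ u n, (A - R) u n = jacobi a (fun n => -b n) u n := by
    intro u n
    rw [sub_apply, lp.coeFn_sub, Pi.sub_apply, hA, hR, jacobi_apply]
    push_cast
    ring
  obtain ⟨q, rfl⟩ := Nat.exists_eq_add_of_le' (by omega : 1 ≤ p)
  push_cast at ha hb
  have key := sub_le_of_isPathConnected_pseudospectrum ha (fun n => by rw [hb]) hT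
    ((sub_sub_cancel A R).symm ▸ hRnorm) hε hconn
  push_cast
  rw [add_sub_cancel_right]
  exact ciSup_le fun i => ciSup_le fun j => abs_sub_le_iff.mpr ⟨key _ _, key _ _⟩
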